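/- arXiv:1004.1936 — 3 statements merged into one kernel-verified Lean document; each statement's English description precedes it below -/
import Mathlib

section
/- Let A be a non-singular n×n complex matrix and let E(A) be the associated evolution algebra. Then every derivation of E(A) is zero; that is, the space of derivations Der(E(A)) is the zero space. -/
open Matrix Polynomial Finset

/-- The multiplication of the evolution algebra `E(A)` on `ℂ^n` associated to the
matrix `A`: it is the unique commutative bilinear multiplication with
`e i · e j = 0` for `i ≠ j` and `e i · e i = ∑ k, A i k • e k`, where `e i = Pi.single i 1`
is the standard (natural) basis. -/
noncomputable def evolMul {n : ℕ} (A : Matrix (Fin n) (Fin n) ℂ) (u v : Fin n → ℂ) : Fin n → ℂ :=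
  fun k => ∑ i, u i * v i * A i k

/-- A linear map `d : E(A) → E(A)` is a derivation if `d (u·v) = d u · v + u · d v`. -/
def IsEvolDerivation {n : ℕ} (A : Matrix (Fin n) (Fin n) ℂ)
    (d : (Fin n → ℂ) →ₗ[ℂ] (Fin n → ℂ)) : Prop :=
  ∀ u v : Fin n → ℂ, d (evolMul A u v) = evolMul A (d u) v + evolMul A u (d v)

lemma evolMul_eq_vecMul {n : ℕ} (A : Matrix (Fin n) (Fin n) ℂ) (u v : Fin n → ℂ) :
    evolMul A u v = (u * v) ᵥ* A :=
  rfl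

/-- When `A` is non-singular, a derivation of `E(A)` is diagonal in the natural basis. -/
lemma IsEvolDerivation.apply_single_of_ne {n : ℕ} {A : Matrix (Fin n) (Fin n) ℂ}
    (hA : A.det ≠ 0) {d : (Fin n → ℂ) →ₗ[ℂ] (Fin n → ℂ)} (hd : IsEvolDerivation A d)
    {i j : Fin n} (hij : i ≠ j) : d (Pi.single i 1) j = 0 := by
  have h := hd (Pi.single i 1) (Pi.single j 1)
  have h0 : (Pi.single i 1 * Pi.single j 1 : Fin n → ℂ) = 0 := by
    ext k
    by_cases hk : k = i
    · subst hk; simp [hij]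
    · simp [hk]
  simp only [evolMul_eq_vecMul, h0, zero_vecMul, map_zero, ← add_vecMul] at h
  simpa [hij.symm] using congrFun (eq_zero_of_vecMul_eq_zero hA h.symm) j

lemma IsEvolDerivation.apply_eq_mul {n : ℕ} {A : Matrix (Fin n) (Fin n) ℂ}
    (hA : A.det ≠ 0) {d : (Fin n → ℂ) →ₗ[ℂ] (Fin n → ℂ)} (hd : IsEvolDerivation A d)
    (x : Fin n → ℂ) (k : Fin n) : d x k = x k * d (Pi.single k 1) k := by
  have hx : x = ∑ i, x i • (Pi.single i 1 : Fin n → ℂ) := by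
    ext j
    simp [Finset.sum_apply, Pi.single_apply]
  conv_lhs => rw [hx, map_sum, Finset.sum_apply]
  rw [Finset.sum_eq_single k]
  · simp
  · intro i _ hik
    simp [hd.apply_single_of_ne hA hik]
  · simp

/-- The diagonal entries of a derivation double along the nonzero entries of `A`. -/
lemma IsEvolDerivation.apply_single_self_eq_two_mul {n : ℕ} {A : Matrix (Fin n) (Fin n) ℂ}
    (hA : A.det ≠ 0) {d : (Fin n → ℂ) →ₗ[ℂ] (Fin n → ℂ)} (hd : IsEvolDerivation A d)
    {i k : Fin n} (hik : A i k ≠ 0) :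
    d (Pi.single k 1) k = 2 * d (Pi.single i 1) i := by
  have h := congrFun (hd (Pi.single i 1) (Pi.single i 1)) k
  rw [hd.apply_eq_mul hA] at h
  simp [evolMul, Pi.single_apply] at h
  refine mul_left_cancel₀ hik ?_
  linear_combination h

/-- If the matrix `A` of the evolution algebra `E(A)` is non-singular, then every
derivation of `E(A)` is zero. -/
theorem derivation_eq_zero_of_det_ne_zero (n : ℕ) (hn : 1 ≤ n)
    (A : Matrix (Fin n) (Fin n) ℂ) (hA : A.det ≠ 0)
    (d : (Fin n → ℂ) →ₗ[ℂ] (Fin n → ℂ)) (hd : IsEvolDerivation A d) :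
    d = 0 := by
  have : Nonempty (Fin n) := ⟨⟨0, hn⟩⟩
  obtain ⟨i, hi⟩ := Finite.exists_max fun i => ‖d (Pi.single i 1) i‖
  obtain ⟨k, hk⟩ : ∃ k, A i k ≠ 0 := by
    by_contra! h
    exact hA (det_eq_zero_of_row_eq_zero i h)
  have hki := hi k
  rw [hd.apply_single_self_eq_two_mul hA hk, norm_mul, Complex.norm_ofNat] at hki
  refine LinearMap.ext fun x => funext fun l => ?_
  have hl : d (Pi.single l 1) l = 0 :=
    norm_le_zero_iff.mp ((hi l).trans (by linarith))
  rw [hd.apply_eq_mul hA x l, hl, mul_zero, LinearMap.zero_apply, Pi.zero_apply]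
end

section
/- Let A ∈ M_n(ℂ) and let d be a derivation of the evolution algebra E(A), with matrix entries d_{ij} defined by d(e_i) = ∑_{j=1}^n d_{ij} e_j. If the first n−1 rows of A (equivalently, the products e_1·e_1, …, e_{n−1}·e_{n−1}) are linearly independent, then d_{ij} = d_{ji} = 0 for all 1 ≤ i ≠ j ≤ n−1. -/
open Matrix Polynomial Finset

theorem evolMul_single_right {n : ℕ} (A : Matrix (Fin n) (Fin n) ℂ) (u : Fin n → ℂ) (j : Fin n) :
    evolMul A u (Pi.single j 1) = u j • A j := by
  ext k
  simp [evolMul, Pi.single_apply]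

theorem evolMul_comm {n : ℕ} (A : Matrix (Fin n) (Fin n) ℂ) (u v : Fin n → ℂ) :
    evolMul A u v = evolMul A v u := by
  ext k
  simp only [evolMul, mul_comm]

theorem evolDerivation_rows_relation {n : ℕ} {A : Matrix (Fin n) (Fin n) ℂ}
    {d : (Fin n → ℂ) →ₗ[ℂ] (Fin n → ℂ)} (hd : IsEvolDerivation A d) {i j : Fin n} (hij : i ≠ j) :
    d (Pi.single i 1) j • A j + d (Pi.single j 1) i • A i = 0 := by
  have h := hd (Pi.single i 1) (Pi.single j 1)
  rw [evolMul_comm A (Pi.single i 1) (d _)] at h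
  simp only [evolMul_single_right, Pi.single_eq_of_ne' hij, zero_smul, map_zero] at h
  exact h.symm

/-- If the first `n-1` rows of `A` (equivalently, the products `eᵢ·eᵢ`, `1 ≤ i ≤ n-1`)
are linearly independent, then `dᵢⱼ = dⱼᵢ = 0` for all `i ≠ j` among the first `n-1`
indices, for any derivation `d` of `E(A)`. -/
theorem derivation_offdiag_eq_zero_of_rows_linearIndependent (n : ℕ) (hn : 2 ≤ n)
    (A : Matrix (Fin n) (Fin n) ℂ)
    (hrows : LinearIndependent ℂ (fun i : Fin (n - 1) => A (Fin.castLE (Nat.sub_le n 1) i)))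
    (d : (Fin n → ℂ) →ₗ[ℂ] (Fin n → ℂ)) (hd : IsEvolDerivation A d) :
    ∀ i j : Fin n, i.val < n - 1 → j.val < n - 1 → i ≠ j →
      d (Pi.single i 1) j = 0 ∧ d (Pi.single j 1) i = 0 := by
  intro i j hi hj hij
  have hpair := hrows.comp ![(⟨i, hi⟩ : Fin (n - 1)), ⟨j, hj⟩] <| by
    intro a b hab
    fin_cases a <;> fin_cases b <;> simp_all [Fin.ext_iff]
  have hrel := evolDerivation_rows_relation hd hij
  have hzero := Fintype.linearIndependent_iff.mp hpair
    ![d (Pi.single j 1) i, d (Pi.single i 1) j] (by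
      simpa [Fin.sum_univ_two, Fin.castLE, add_comm] using hrel)
  exact ⟨by simpa using hzero 1, by simpa using hzero 0⟩
end

section
/- Let A ∈ M_n(ℂ) be such that its first n−1 rows are linearly independent and e_n·e_n = ∑_{k=1}^{n−1} b_k (e_k·e_k) for some b_1,…,b_{n−1} ∈ ℂ (so rank A = n−1). If b_p ≠ 0 and b_q ≠ 0 for some 1 ≤ p ≠ q ≤ n−1, then every derivation of E(A) is zero. -/
open Matrix Polynomial Finset

theorem evolMul_single_left {n : ℕ} (A : Matrix (Fin n) (Fin n) ℂ) (u : Fin n → ℂ) (j : Fin n) :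
    evolMul A (Pi.single j 1) u = u j • A j := by
  funext k
  simp [evolMul, Pi.single_apply]

/-- If the rows of `A` are nonzero and pairwise linearly independent, then `E(A)` has no nonzero
derivation: any derivation is diagonal, and its set of eigenvalues is stable under doubling. -/
theorem IsEvolDerivation.eq_zero {n : ℕ} {A : Matrix (Fin n) (Fin n) ℂ}
    {d : (Fin n → ℂ) →ₗ[ℂ] (Fin n → ℂ)} (hd : IsEvolDerivation A d)
    (hne : ∀ i, A i ≠ 0)
    (hpair : ∀ i j, i ≠ j → ∀ s t : ℂ, s • A i + t • A j = 0 → s = 0) :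
    d = 0 := by
  have hoff : ∀ i j, i ≠ j → d (Pi.single i 1) j = 0 := by
    intro i j hij
    have h := hd (Pi.single i 1) (Pi.single j 1)
    rw [evolMul_single_right, evolMul_single_right, evolMul_single_left,
      Pi.single_eq_of_ne hij.symm, zero_smul, map_zero] at h
    exact hpair j i hij.symm _ _ h.symm
  have hcoord : ∀ (v : Fin n → ℂ) (k), d v k = v k * d (Pi.single k 1) k := by
    intro v k
    conv_lhs => rw [pi_eq_sum_univ' v]
    rw [map_sum, Finset.sum_apply, Finset.sum_eq_single k]
    · rw [map_smul, Pi.smul_apply, smul_eq_mul]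
    · intro i _ hik
      rw [map_smul, Pi.smul_apply, hoff i k hik, smul_zero]
    · simp
  have hdouble : ∀ i, ∃ k, d (Pi.single k 1) k = 2 * d (Pi.single i 1) i := by
    intro i
    obtain ⟨k, hk⟩ := Function.ne_iff.mp (hne i)
    refine ⟨k, mul_left_cancel₀ hk ?_⟩
    have h := congrFun (hd (Pi.single i 1) (Pi.single i 1)) k
    rw [evolMul_single_right, evolMul_single_right, evolMul_single_left,
      Pi.single_eq_same, one_smul, hcoord] at h
    simp only [Pi.add_apply, Pi.smul_apply, smul_eq_mul] at h
    rw [h]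
    ring
  have hzero : ∀ i, d (Pi.single i 1) i = 0 := by
    intro i
    obtain ⟨m, -, hm⟩ := Finset.exists_max_image Finset.univ
      (fun j => ‖d (Pi.single j 1) j‖) ⟨i, Finset.mem_univ i⟩
    obtain ⟨k, hk⟩ := hdouble m
    have h1 := hm k (Finset.mem_univ k)
    have h2 := hm i (Finset.mem_univ i)
    simp only [hk, norm_mul, Complex.norm_ofNat] at h1 h2
    exact norm_le_zero_iff.mp (by linarith)
  refine LinearMap.ext fun v => funext fun k => ?_
  simp [hcoord v k, hzero k]

/-- Suppose the first `n-1` rows of `A` are linearly independent and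
`eₙ·eₙ = ∑_{k=1}^{n-1} bₖ (eₖ·eₖ)`.  If `b_p ≠ 0` and `b_q ≠ 0` for two distinct indices
`p ≠ q` among `1,…,n-1`, then every derivation of `E(A)` is zero. -/
theorem derivation_eq_zero_of_two_nonzero_coeffs (n : ℕ) (hn : 3 ≤ n)
    (A : Matrix (Fin n) (Fin n) ℂ)
    (hrows : LinearIndependent ℂ (fun i : Fin (n - 1) => A (Fin.castLE (Nat.sub_le n 1) i)))
    (b : Fin (n - 1) → ℂ)
    (hlast : evolMul A (Pi.single (⟨n - 1, by omega⟩ : Fin n) 1)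
        (Pi.single (⟨n - 1, by omega⟩ : Fin n) 1)
      = ∑ k : Fin (n - 1), b k •
          evolMul A (Pi.single (Fin.castLE (Nat.sub_le n 1) k) 1)
            (Pi.single (Fin.castLE (Nat.sub_le n 1) k) 1))
    (p q : Fin (n - 1)) (hpq : p ≠ q) (hp : b p ≠ 0) (hq : b q ≠ 0)
    (d : (Fin n → ℂ) →ₗ[ℂ] (Fin n → ℂ)) (hd : IsEvolDerivation A d) :
    d = 0 := by
  simp only [evolMul_single_right, Pi.single_eq_same, one_smul] at hlast
  set R : Fin (n - 1) → Fin n → ℂ := fun i => A (Fin.castLE (Nat.sub_le n 1) i) with hR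
  have hcases : ∀ i : Fin n, i = ⟨n - 1, by omega⟩ ∨ ∃ k, i = Fin.castLE (Nat.sub_le n 1) k := by
    intro i
    by_cases h : (i : ℕ) < n - 1
    · exact Or.inr ⟨⟨i, h⟩, rfl⟩
    · exact Or.inl (Fin.ext (by have := i.isLt; simp only; omega))
  have hlast_smul : ∀ (i : Fin (n - 1)) (s t : ℂ),
      s • A ⟨n - 1, by omega⟩ + t • R i = 0 → s = 0 ∧ t = 0 := by
    intro i s t h
    have hsum : ∑ k, (s * b k + if k = i then t else 0) • R k = 0 := by
      rw [← h, hlast]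
      simp [add_smul, Finset.sum_add_distrib, Finset.smul_sum, mul_smul, ite_smul, hR]
    have hcoeff := Fintype.linearIndependent_iff.mp hrows _ hsum
    have hs : s = 0 := by
      rcases eq_or_ne p i with rfl | hpi
      · simpa [hpq.symm, hq] using hcoeff q
      · simpa [hpi, hp] using hcoeff p
    exact ⟨hs, by simpa [hs] using hcoeff i⟩
  refine hd.eq_zero ?_ ?_
  · intro i hi
    rcases hcases i with rfl | ⟨k, rfl⟩
    · exact one_ne_zero (hlast_smul p 1 0 (by simp [hi])).1
    · exact hrows.ne_zero k hi
  · intro i j hij s t h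
    rcases hcases i with rfl | ⟨k, rfl⟩ <;> rcases hcases j with rfl | ⟨l, rfl⟩
    · exact absurd rfl hij
    · exact (hlast_smul l s t h).1
    · exact (hlast_smul k t s (by rw [add_comm]; exact h)).2
    · have hkl : k ≠ l := fun e => hij (by rw [e])
      have hsum : ∑ m, ((if m = k then s else 0) + if m = l then t else 0) • R m = 0 := by
        simpa [add_smul, Finset.sum_add_distrib, ite_smul] using h
      simpa [hkl] using Fintype.linearIndependent_iff.mp hrows _ hsum k
end
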